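/- For every periodic point τ of the doubling map D (i.e. τ = k/(2^p − 1) mod 1 for some p ≥ 1 and 0 ≤ k ≤ 2^p − 2), there exists a tongue of type τ: a connected component S of the set of parameters whose attracting orbit has a single minus slope itinerary, such that the closure of S intersects ℝ/ℤ × {1} in a nondegenerate interval and, for every (a,b) ∈ S, φ_{a,b}(x₀(a,b)) = τ, where x₀(a,b) is the point of the attracting orbit of f_{a,b} lying in I_−. -/

import Mathlib

open Set Filter Topology

noncomputable section

/-- Representative of a point of the circle in `[0,1)`. -/
noncomputable def rep (z : UnitAddCircle) : ℝ := (AddCircle.equivIco 1 0 z).val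

/-- The straight sine map on `[0,1)`. -/
noncomputable def Sfun (t : ℝ) : ℝ := if t ≤ 1/2 then 4*t - 1 else -4*t + 3

/-- The piecewise linear perturbation of the doubling map. -/
noncomputable def plpdm (a : UnitAddCircle) (b : ℝ) (z : UnitAddCircle) : UnitAddCircle :=
  ((2 * rep z + (b/2) * Sfun (rep z) : ℝ) : UnitAddCircle) + a

/-- The doubling map. -/
def Dbl (z : UnitAddCircle) : UnitAddCircle := z + z

/-- `x` is an attracting periodic point of `f` of exact period `n`. -/
def IsAttractingPeriodicPt (f : UnitAddCircle → UnitAddCircle) (n : ℕ)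
    (x : UnitAddCircle) : Prop :=
  0 < n ∧ f^[n] x = x ∧ (∀ m, 0 < m → m < n → f^[m] x ≠ x) ∧
  ∃ U : Set UnitAddCircle, IsOpen U ∧ IsConnected U ∧ x ∈ U ∧ f^[n] '' U ⊆ U ∧
    ∀ y ∈ U, Tendsto (fun k => f^[n*k] y) atTop (nhds x)

/-- Forward orbit of `x` under `f`. -/
def orbitSet (f : UnitAddCircle → UnitAddCircle) (x : UnitAddCircle) : Set UnitAddCircle :=
  {y | ∃ i, f^[i] x = y}

/-- Basin of attraction of the set `O`. -/
def basin (f : UnitAddCircle → UnitAddCircle) (O : Set UnitAddCircle) : Set UnitAddCircle :=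
  {y | Tendsto (fun k => Metric.infDist (f^[k] y) O) atTop (nhds 0)}

/-- Immediate basin of attraction of the orbit `O`. -/
def immBasin (f : UnitAddCircle → UnitAddCircle) (O : Set UnitAddCircle) :
    Set UnitAddCircle :=
  ⋃ z ∈ O, connectedComponentIn (basin f O) z

/-- The hyperbolic set `H`. -/
def hypSet : Set (UnitAddCircle × ℝ) :=
  {q | q.2 ∈ Set.Ico (0:ℝ) 1 ∧ ∃ n x, IsAttractingPeriodicPt (plpdm q.1 q.2) n x}

/-- The lift `F_{a,b}` of `f_{a,b}`, normalized so that `F_{a,b}(0) ∈ [0,1)`. -/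
noncomputable def liftF (a : UnitAddCircle) (b : ℝ) (x : ℝ) : ℝ :=
  (2 * Int.fract x + rep a + (b/2) * Sfun (Int.fract x)
    + (if rep a - b/2 < 0 then 1 else 0)) + 2 * (⌊x⌋ : ℝ)

/-- `Φ_{a,b}`, the limit of `F_{a,b}^n(x)/2^n`. -/
noncomputable def Phi (a : UnitAddCircle) (b : ℝ) (x : ℝ) : ℝ :=
  limUnder atTop (fun n : ℕ => (liftF a b)^[n] x / 2 ^ n)

/-- The semiconjugacy `φ_{a,b}` induced by `Φ_{a,b}`. -/
noncomputable def phiMap (a : UnitAddCircle) (b : ℝ) (z : UnitAddCircle) : UnitAddCircle :=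
  ((Phi a b (rep z) : ℝ) : UnitAddCircle)

/-- The arc `I₊ = [0,1/2]` of the circle. -/
def Iplus : Set UnitAddCircle := (fun t : ℝ => (t : UnitAddCircle)) '' Set.Icc 0 (1/2)

/-- The arc `I₋ = [1/2,1]` of the circle. -/
def Iminus : Set UnitAddCircle := (fun t : ℝ => (t : UnitAddCircle)) '' Set.Icc (1/2) 1

/-- The orbit of `x` (of period `p`) avoids `0`, `1/2` and has slope itinerary `σ`,
where `σ j = true` encodes the symbol `−` and `σ j = false` encodes `+`. -/
def HasItinerary (f : UnitAddCircle → UnitAddCircle) (p : ℕ) (x : UnitAddCircle)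
    (σ : Fin p → Bool) : Prop :=
  (∀ j : Fin p, f^[(j : ℕ)] x ≠ (0 : UnitAddCircle) ∧
      f^[(j : ℕ)] x ≠ (((1:ℝ)/2 : ℝ) : UnitAddCircle)) ∧
  ∀ j : Fin p, (σ j = true → f^[(j : ℕ)] x ∈ Iminus) ∧ (σ j = false → f^[(j : ℕ)] x ∈ Iplus)

/-- The set `P_σ` of parameters whose attracting orbit has slope itinerary `σ`. -/
def paramSet (p : ℕ) (σ : Fin p → Bool) : Set (UnitAddCircle × ℝ) :=
  {q | q.2 ∈ Set.Ico (0:ℝ) 1 ∧ ∃ x, IsAttractingPeriodicPt (plpdm q.1 q.2) p x ∧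
       HasItinerary (plpdm q.1 q.2) p x σ}

/-- `S` is a tongue: its closure meets `ℝ/ℤ × {1}` in a nondegenerate interval. -/
def IsTongue (S : Set (UnitAddCircle × ℝ)) : Prop :=
  ∃ u v : ℝ, u < v ∧ ∀ t ∈ Set.Icc u v, (((t : ℝ) : UnitAddCircle), (1:ℝ)) ∈ closure S

end

/-- Parameters whose corresponding map has an attracting periodic orbit with a
single minus slope itinerary (of some length). -/
def singleMinusParams : Set (UnitAddCircle × ℝ) :=
  {q | q.2 ∈ Set.Ico (0:ℝ) 1 ∧ ∃ (m : ℕ) (x : UnitAddCircle) (σ : Fin m → Bool),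
    (∃! j : Fin m, σ j = true) ∧ IsAttractingPeriodicPt (plpdm q.1 q.2) m x ∧
    HasItinerary (plpdm q.1 q.2) m x σ}


/-- The circle points of two reals agree iff the reals differ by an integer. -/
lemma coe_eq_coe_iff_int {x y : ℝ} :
    (x : UnitAddCircle) = (y : UnitAddCircle) ↔ ∃ n : ℤ, x = y + n := by
  rw [← sub_eq_zero, ← AddCircle.coe_sub, AddCircle.coe_eq_zero_iff]
  constructor
  · rintro ⟨n, hn⟩
    exact ⟨n, by simp at hn; linarith⟩
  · rintro ⟨n, hn⟩
    exact ⟨n, by simp; linarith⟩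

lemma coe_add_int (x : ℝ) (n : ℤ) : ((x + n : ℝ) : UnitAddCircle) = x :=
  coe_eq_coe_iff_int.2 ⟨n, rfl⟩

lemma int_eq_zero_of_lt {n : ℤ} (h₁ : (n : ℝ) < 1) (h₂ : (-1 : ℝ) < n) : n = 0 := by
  have h₁' : n < 1 := by exact_mod_cast h₁
  have h₂' : -1 < n := by exact_mod_cast h₂
  omega

lemma eq_of_coe_eq {x y : ℝ} (h : (x : UnitAddCircle) = y) (h₁ : x - y < 1) (h₂ : y - x < 1) :
    x = y := by
  obtain ⟨n, hn⟩ := coe_eq_coe_iff_int.1 h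
  have : n = 0 := int_eq_zero_of_lt (by linarith) (by linarith)
  simpa [this] using hn

lemma rep_coe (x : ℝ) : rep (x : UnitAddCircle) = Int.fract x := by
  simp [rep, AddCircle.coe_equivIco_mk_apply]

/-- The straight sine map as a 1-periodic function on the line. -/
noncomputable def tri (x : ℝ) : ℝ := 4 * ‖(x : UnitAddCircle)‖ - 1

lemma tri_add_int (x : ℝ) (n : ℤ) : tri (x + n) = tri x := by
  rw [tri, coe_add_int, tri]

lemma tri_of_le {t : ℝ} (h₀ : 0 ≤ t) (h₁ : t ≤ 1 / 2) : tri t = 4 * t - 1 := by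
  have : ‖(t : UnitAddCircle)‖ = |t| :=
    (AddCircle.norm_coe_eq_abs_iff 1 one_ne_zero).2 (by rw [abs_of_nonneg h₀]; simpa using h₁)
  rw [tri, this, abs_of_nonneg h₀]

lemma tri_of_ge {t : ℝ} (h₀ : 1 / 2 ≤ t) (h₁ : t ≤ 1) : tri t = -4 * t + 3 := by
  have h : tri t = tri (t - 1) := by
    have := tri_add_int (t - 1) 1
    simpa using this
  have : ‖((t - 1 : ℝ) : UnitAddCircle)‖ = |t - 1| :=
    (AddCircle.norm_coe_eq_abs_iff 1 one_ne_zero).2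
      (by rw [abs_of_nonpos (by linarith)]; norm_num; linarith)
  rw [h, tri, this, abs_of_nonpos (by linarith)]
  ring

lemma Sfun_fract (x : ℝ) : Sfun (Int.fract x) = tri x := by
  have h : tri x = tri (Int.fract x) := by
    conv_lhs => rw [← Int.fract_add_floor x, tri_add_int]
  rw [h, Sfun]
  split_ifs with hx
  · rw [tri_of_le (Int.fract_nonneg x) hx]
  · rw [tri_of_ge (by linarith) (Int.fract_lt_one x).le]

lemma abs_tri_sub_le (x y : ℝ) : |tri x - tri y| ≤ 4 * |x - y| := by
  have h₁ : |‖(x : UnitAddCircle)‖ - ‖(y : UnitAddCircle)‖| ≤ |x - y| := by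
    refine (abs_norm_sub_norm_le _ _).trans ?_
    rw [← AddCircle.coe_sub]
    exact QuotientAddGroup.norm_mk_le_norm
  rw [show tri x - tri y = 4 * (‖(x : UnitAddCircle)‖ - ‖(y : UnitAddCircle)‖) by
    simp only [tri]; ring, abs_mul, abs_of_pos (by norm_num : (0 : ℝ) < 4)]
  linarith

lemma continuous_tri : Continuous tri := by
  unfold tri
  have : Continuous fun x : ℝ => (x : UnitAddCircle) := AddCircle.continuous_mk' 1
  fun_prop

/-- The lift of `plpdm α b` to the line with translation part `α : ℝ`. -/
noncomputable def lineMap (α b x : ℝ) : ℝ := 2 * x + α + (b / 2) * tri x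

lemma plpdm_coe (α b x : ℝ) : plpdm α b x = (lineMap α b x : ℝ) := by
  rw [plpdm, rep_coe, Sfun_fract, ← AddCircle.coe_add, coe_eq_coe_iff_int]
  refine ⟨-2 * ⌊x⌋, ?_⟩
  have := Int.fract_add_floor x
  push_cast
  rw [lineMap]
  linarith

lemma plpdm_iterate_coe (α b x : ℝ) (j : ℕ) :
    (plpdm α b)^[j] x = ((lineMap α b)^[j] x : ℝ) := by
  induction j with
  | zero => rfl
  | succ j ih => rw [Function.iterate_succ_apply', ih, plpdm_coe, Function.iterate_succ_apply']

lemma lineMap_add_int (α b x : ℝ) (n : ℤ) :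
    lineMap α b (x + n) = lineMap α b x + 2 * n := by
  rw [lineMap, lineMap, tri_add_int]
  ring

lemma lineMap_iterate_add_int (α b x : ℝ) (n : ℤ) (j : ℕ) :
    (lineMap α b)^[j] (x + n) = (lineMap α b)^[j] x + 2 ^ j * n := by
  induction j with
  | zero => simp
  | succ j ih =>
    rw [Function.iterate_succ_apply', ih, Function.iterate_succ_apply']
    have := lineMap_add_int α b ((lineMap α b)^[j] x) (2 ^ j * n)
    push_cast at this
    rw [this]
    ring

lemma lineMap_param_add_int_iterate (α b x : ℝ) (l : ℤ) (j : ℕ) :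
    (lineMap (α + l) b)^[j] x = (lineMap α b)^[j] x + (2 ^ j - 1) * l := by
  induction j with
  | zero => simp
  | succ j ih =>
    rw [Function.iterate_succ_apply', ih, Function.iterate_succ_apply']
    have := lineMap_add_int (α + l) b ((lineMap α b)^[j] x) ((2 ^ j - 1) * l)
    push_cast at this
    rw [this, lineMap, lineMap]
    ring

lemma liftF_eq_lineMap (α b : ℝ) :
    ∃ l : ℤ, liftF α b = lineMap (α + l) b := by
  refine ⟨-⌊α⌋ + (if rep (α : UnitAddCircle) - b / 2 < 0 then 1 else 0), ?_⟩
  funext x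
  rw [liftF, Sfun_fract, lineMap, rep_coe]
  have h₁ := Int.fract_add_floor x
  have h₂ := Int.fract_add_floor α
  push_cast
  linarith

lemma continuous_lineMap_iterate (j : ℕ) :
    Continuous fun q : (ℝ × ℝ) × ℝ => (lineMap q.1.1 q.1.2)^[j] q.2 := by
  induction j with
  | zero => exact continuous_snd
  | succ j ih =>
    simp only [Function.iterate_succ_apply', lineMap]
    have := continuous_tri.comp ih
    simp only [Function.comp_def] at this
    fun_prop

lemma continuous_lineMap_iterate_right (α b : ℝ) (j : ℕ) :
    Continuous (lineMap α b)^[j] :=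
  (continuous_lineMap_iterate j).comp (Continuous.prodMk_right (α, b))

lemma lineMap_sub (α b x y : ℝ) :
    lineMap α b x - lineMap α b y = 2 * (x - y) + b / 2 * (tri x - tri y) := by
  rw [lineMap, lineMap]; ring

lemma abs_lineMap_sub_le {α b : ℝ} (hb : 0 ≤ b) (x y : ℝ) :
    |lineMap α b x - lineMap α b y| ≤ (2 + 2 * b) * |x - y| := by
  rw [lineMap_sub]
  refine (abs_add_le _ _).trans ?_
  rw [abs_mul, abs_mul, abs_of_pos (by norm_num : (0 : ℝ) < 2),
    abs_of_nonneg (by positivity : 0 ≤ b / 2)]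
  nlinarith [abs_tri_sub_le x y]

lemma lineMap_sub_ge {α b : ℝ} (hb : 0 ≤ b) {x y : ℝ} (h : y ≤ x) :
    (2 - 2 * b) * (x - y) ≤ lineMap α b x - lineMap α b y := by
  rw [lineMap_sub]
  have := neg_le_of_abs_le (abs_tri_sub_le x y)
  rw [abs_of_nonneg (by linarith)] at this
  nlinarith

lemma monotone_lineMap {α b : ℝ} (hb : 0 ≤ b) (hb' : b ≤ 1) : Monotone (lineMap α b) := by
  intro x y h
  have := lineMap_sub_ge (α := α) hb h
  nlinarith

lemma strictMono_lineMap {α b : ℝ} (hb : 0 ≤ b) (hb' : b < 1) : StrictMono (lineMap α b) := by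
  intro x y h
  have := lineMap_sub_ge (α := α) hb h.le
  nlinarith

lemma lineMap_sub_of_plus {α b x y : ℝ} (n : ℤ) (hx : x ∈ Icc (n : ℝ) (n + 1 / 2))
    (hy : y ∈ Icc (n : ℝ) (n + 1 / 2)) :
    lineMap α b x - lineMap α b y = (2 + 2 * b) * (x - y) := by
  have h : ∀ z ∈ Icc (n : ℝ) (n + 1 / 2), tri z = 4 * (z - n) - 1 := fun z hz => by
    rw [← tri_of_le (sub_nonneg.2 hz.1) (by linarith [hz.2]), ← tri_add_int (z - n) n]
    simp
  rw [lineMap_sub, h x hx, h y hy]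
  ring

lemma lineMap_sub_of_minus {α b x y : ℝ} (n : ℤ) (hx : x ∈ Icc (n + 1 / 2 : ℝ) (n + 1))
    (hy : y ∈ Icc (n + 1 / 2 : ℝ) (n + 1)) :
    lineMap α b x - lineMap α b y = (2 - 2 * b) * (x - y) := by
  have h : ∀ z ∈ Icc (n + 1 / 2 : ℝ) (n + 1), tri z = -4 * (z - n) + 3 := fun z hz => by
    rw [← tri_of_ge (by linarith [hz.1]) (by linarith [hz.2]), ← tri_add_int (z - n) n]
    simp
  rw [lineMap_sub, h x hx, h y hy]
  ring

/-- A periodic point of the lift modulo translation has an explicit rotation number. -/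
lemma tendsto_lineMap_iterate_div {α b X : ℝ} {m : ℕ} {N : ℤ} (hm : 0 < m)
    (h : (lineMap α b)^[m] X = X + N) :
    Tendsto (fun n : ℕ => (lineMap α b)^[n] X / 2 ^ n) atTop (𝓝 (N / (2 ^ m - 1))) := by
  set L : ℝ := N / (2 ^ m - 1) with hL
  have h2 : (2 : ℝ) ^ m - 1 ≠ 0 := by
    have : (1 : ℝ) < 2 ^ m := one_lt_pow₀ (by norm_num) hm.ne'
    linarith
  have hN : (N : ℝ) = L * (2 ^ m - 1) := by rw [hL]; field_simp
  set g : ℕ → ℝ := fun n => (lineMap α b)^[n] X - 2 ^ n * L with hg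
  have hper : Function.Periodic g m := fun n => by
    simp only [hg]
    rw [Function.iterate_add_apply, h, lineMap_iterate_add_int, hN]
    ring
  obtain ⟨C, hC⟩ : ∃ C, ∀ n, |g n| ≤ C := by
    refine ⟨∑ i ∈ Finset.range m, |g i|, fun n => ?_⟩
    rw [← hper.map_mod_nat n]
    exact Finset.single_le_sum (f := fun i => |g i|) (fun i _ => abs_nonneg _)
      (Finset.mem_range.2 (Nat.mod_lt n hm))
  have hz : Tendsto (fun n : ℕ => g n * (1 / 2 : ℝ) ^ n) atTop (𝓝 0) := by
    refine squeeze_zero_norm (a := fun n => C * (1 / 2 : ℝ) ^ n) (fun n => ?_) ?_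
    · rw [Real.norm_eq_abs, abs_mul, abs_of_pos (by positivity : (0 : ℝ) < (1 / 2) ^ n)]
      exact mul_le_mul_of_nonneg_right (hC n) (by positivity)
    · simpa using (tendsto_pow_atTop_nhds_zero_of_lt_one (by norm_num : (0 : ℝ) ≤ 1 / 2)
        (by norm_num)).const_mul C
  have := hz.add_const L
  rw [zero_add] at this
  refine this.congr fun n => ?_
  simp only [hg, one_div, inv_pow]
  field_simp
  ring

lemma phiMap_of_periodic {α b X : ℝ} {m : ℕ} {N : ℤ} (hm : 0 < m) (hX : X ∈ Ico (0 : ℝ) 1)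
    (h : (lineMap α b)^[m] X = X + N) :
    phiMap α b X = ((N / (2 ^ m - 1) : ℝ) : UnitAddCircle) := by
  obtain ⟨l, hl⟩ := liftF_eq_lineMap α b
  have h2 : (2 : ℝ) ^ m - 1 ≠ 0 := by
    have : (1 : ℝ) < 2 ^ m := one_lt_pow₀ (by norm_num) hm.ne'
    linarith
  have h' : (lineMap (α + l) b)^[m] X = X + ((N + (2 ^ m - 1) * l : ℤ) : ℝ) := by
    rw [lineMap_param_add_int_iterate, h]
    push_cast
    ring
  rw [phiMap, rep_coe, Int.fract_eq_self.2 hX, Phi, hl,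
    (tendsto_lineMap_iterate_div hm h').limUnder_eq, coe_eq_coe_iff_int]
  refine ⟨l, ?_⟩
  push_cast
  field_simp

/-- `X ∈ (1/2, 1)` satisfies `F^m X = X + N` for the lift `F` of the map with parameters `(α, b)`,
and an orbit with a single minus symbol contracts over `m` steps. -/
structure SingleMinusPt (α b : ℝ) (m : ℕ) (N : ℤ) (X : ℝ) : Prop where
  nonneg : 0 ≤ b
  le_one : b ≤ 1
  pos : 0 < m
  mem : X ∈ Ioo (1 / 2 : ℝ) 1
  iterate_eq : (lineMap α b)^[m] X = X + N
  contracting : (2 + 2 * b) ^ (m - 1) * (2 - 2 * b) < 1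

lemma abs_iterate_sub_le {α b X z : ℝ} (hb : 0 ≤ b) (hb' : b ≤ 1)
    (hX : X ∈ Icc (1 / 2 : ℝ) 1) (hz : z ∈ Icc (1 / 2 : ℝ) 1) (j : ℕ) :
    |(lineMap α b)^[j + 1] z - (lineMap α b)^[j + 1] X| ≤
      (2 + 2 * b) ^ j * (2 - 2 * b) * |z - X| := by
  induction j with
  | zero =>
    have := lineMap_sub_of_minus (α := α) (b := b) (x := z) (y := X) 0
      (by constructor <;> simp <;> linarith [hz.1, hz.2])
      (by constructor <;> simp <;> linarith [hX.1, hX.2])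
    simp [this, abs_mul, abs_of_nonneg (by linarith : 0 ≤ 2 - 2 * b)]
  | succ j ih =>
    rw [Function.iterate_succ_apply', Function.iterate_succ_apply' _ (j + 1)]
    refine (abs_lineMap_sub_le hb _ _).trans ?_
    calc _ ≤ (2 + 2 * b) * ((2 + 2 * b) ^ j * (2 - 2 * b) * |z - X|) := by gcongr
      _ = _ := by ring

namespace SingleMinusPt

variable {α b : ℝ} {m : ℕ} {N : ℤ} {X : ℝ}

lemma mem_Icc (h : SingleMinusPt α b m N X) : X ∈ Icc (1 / 2 : ℝ) 1 :=
  ⟨h.mem.1.le, h.mem.2.le⟩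

lemma rate_nonneg (h : SingleMinusPt α b m N X) : 0 ≤ (2 + 2 * b) ^ (m - 1) * (2 - 2 * b) := by
  have h₁ := h.nonneg
  have h₂ := h.le_one
  exact mul_nonneg (by positivity) (by linarith)

lemma abs_sub_le (h : SingleMinusPt α b m N X) {z : ℝ} (hz : z ∈ Icc (1 / 2 : ℝ) 1) :
    |(lineMap α b)^[m] z - N - X| ≤ (2 + 2 * b) ^ (m - 1) * (2 - 2 * b) * |z - X| := by
  have := abs_iterate_sub_le (α := α) h.nonneg h.le_one h.mem_Icc hz (m - 1)
  rw [Nat.sub_add_cancel h.pos, h.iterate_eq] at this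
  rwa [show (lineMap α b)^[m] z - N - X = (lineMap α b)^[m] z - (X + N) by ring]

lemma mem_uIcc (h : SingleMinusPt α b m N X) {z : ℝ} (hz : z ∈ Icc (1 / 2 : ℝ) 1) :
    (lineMap α b)^[m] z - N ∈ uIcc X z := by
  have h₁ : |(lineMap α b)^[m] z - N - X| ≤ |z - X| :=
    (h.abs_sub_le hz).trans (mul_le_of_le_one_left (abs_nonneg _) h.contracting.le)
  have hmono := (monotone_lineMap (α := α) h.nonneg h.le_one).iterate m
  rcases le_total X z with hle | hle
  · rw [uIcc_of_le hle]
    have := hmono hle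
    rw [h.iterate_eq] at this
    rw [abs_of_nonneg (sub_nonneg.2 hle)] at h₁
    have := le_of_abs_le h₁
    constructor <;> linarith
  · rw [uIcc_of_ge hle]
    have := hmono hle
    rw [h.iterate_eq] at this
    rw [abs_of_nonpos (sub_nonpos.2 hle)] at h₁
    have := neg_le_of_abs_le h₁
    constructor <;> linarith

/-- The arc of minus slope is trapped by the single minus orbit. -/
lemma iterate_mul (h : SingleMinusPt α b m N X) {z : ℝ} (hz : z ∈ Icc (1 / 2 : ℝ) 1) (k : ℕ) :
    ∃ M : ℤ, (lineMap α b)^[m * k] z - M ∈ Icc (1 / 2 : ℝ) 1 ∧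
      |(lineMap α b)^[m * k] z - M - X| ≤
        ((2 + 2 * b) ^ (m - 1) * (2 - 2 * b)) ^ k * |z - X| := by
  induction k with
  | zero => exact ⟨0, by simpa using hz, by simp⟩
  | succ k ih =>
    obtain ⟨M, hM, hM'⟩ := ih
    refine ⟨N + 2 ^ m * M, ?_⟩
    have e : (lineMap α b)^[m * (k + 1)] z - ((N + 2 ^ m * M : ℤ) : ℝ) =
        (lineMap α b)^[m] ((lineMap α b)^[m * k] z - M) - N := by
      have := lineMap_iterate_add_int α b ((lineMap α b)^[m * k] z - M) M m
      rw [sub_add_cancel, ← Function.iterate_add_apply] at this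
      rw [show m * (k + 1) = m + m * k by ring, this]
      push_cast
      ring
    rw [e]
    refine ⟨uIcc_subset_Icc h.mem_Icc hM (h.mem_uIcc hM), (h.abs_sub_le hM).trans ?_⟩
    calc _ ≤ (2 + 2 * b) ^ (m - 1) * (2 - 2 * b) *
          (((2 + 2 * b) ^ (m - 1) * (2 - 2 * b)) ^ k * |z - X|) :=
          mul_le_mul_of_nonneg_left hM' h.rate_nonneg
      _ = _ := by ring

/-- The single minus point is the only periodic point on the arc of minus slope. -/
lemma eq_of_periodic (h : SingleMinusPt α b m N X) {Y : ℝ} (hY : Y ∈ Icc (1 / 2 : ℝ) 1) {n : ℕ}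
    (hn : 0 < n) (hp : Function.IsPeriodicPt (plpdm α b) n (Y : UnitAddCircle)) : Y = X := by
  have hp' : (plpdm α b)^[m * n] (Y : UnitAddCircle) = Y := hp.const_mul m
  rw [plpdm_iterate_coe] at hp'
  obtain ⟨M, hM, hM'⟩ := h.iterate_mul hY n
  have e : (lineMap α b)^[m * n] Y - M = Y := by
    refine eq_of_coe_eq ?_ (by linarith [hM.1, hM.2, hY.1, hY.2])
      (by linarith [hM.1, hM.2, hY.1, hY.2])
    rw [← hp']
    exact coe_eq_coe_iff_int.2 ⟨-M, by push_cast; ring⟩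
  rw [e] at hM'
  have h₁ := pow_lt_one₀ h.rate_nonneg h.contracting hn.ne'
  by_contra hne
  have : 0 < |Y - X| := abs_pos.2 (sub_ne_zero.2 hne)
  nlinarith

lemma tendsto (h : SingleMinusPt α b m N X) {z : ℝ} (hz : z ∈ Icc (1 / 2 : ℝ) 1) :
    Tendsto (fun k => (plpdm α b)^[m * k] (z : UnitAddCircle)) atTop (𝓝 (X : UnitAddCircle)) := by
  choose M hM hM' using h.iterate_mul hz
  have h₀ : Tendsto (fun k => (lineMap α b)^[m * k] z - M k - X) atTop (𝓝 0) :=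
    squeeze_zero_norm hM' (by
      simpa using (tendsto_pow_atTop_nhds_zero_of_lt_one h.rate_nonneg
        h.contracting).mul_const |z - X|)
  have h₁ := h₀.add_const X
  rw [zero_add] at h₁
  have h₂ := ((AddCircle.continuous_mk' (1 : ℝ)).tendsto X).comp h₁
  refine h₂.congr fun k => ?_
  rw [plpdm_iterate_coe]
  exact coe_eq_coe_iff_int.2 ⟨-M k, by push_cast; ring⟩

lemma isPeriodicPt (h : SingleMinusPt α b m N X) :
    (plpdm α b)^[m] (X : UnitAddCircle) = X := by
  rw [plpdm_iterate_coe, h.iterate_eq, coe_add_int]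

lemma isAttractingPeriodicPt (h : SingleMinusPt α b m N X)
    (hmin : ∀ i, 0 < i → i < m → (plpdm α b)^[i] (X : UnitAddCircle) ≠ X) :
    IsAttractingPeriodicPt (plpdm α b) m (X : UnitAddCircle) := by
  refine ⟨h.pos, h.isPeriodicPt, hmin, (fun t : ℝ => (t : UnitAddCircle)) '' Ioo (1 / 2) 1,
    QuotientAddGroup.isOpenMap_coe _ isOpen_Ioo,
    (isConnected_Ioo (by norm_num)).image _ (AddCircle.continuous_mk' 1).continuousOn,
    ⟨X, h.mem, rfl⟩, ?_, ?_⟩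
  · rintro _ ⟨_, ⟨z, hz, rfl⟩, rfl⟩
    refine ⟨(lineMap α b)^[m] z - N, ?_, ?_⟩
    · have := h.mem_uIcc ⟨hz.1.le, hz.2.le⟩
      exact ordConnected_Ioo.uIcc_subset h.mem hz this
    · simp only [plpdm_iterate_coe]
      exact coe_eq_coe_iff_int.2 ⟨-N, by push_cast; ring⟩
  · rintro _ ⟨z, hz, rfl⟩
    exact h.tendsto ⟨hz.1.le, hz.2.le⟩

/-- The single minus point persists under perturbation of the parameters. -/
lemma persists (h : SingleMinusPt α b m N X) {s : Set ℝ} (hs : s ∈ 𝓝 X) :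
    ∀ᶠ q : ℝ × ℝ in 𝓝 (α, b), ∃ X' ∈ s, (lineMap q.1 q.2)^[m] X' = X' + N := by
  have hs' : s ∩ Ioo (1 / 2) 1 ∈ 𝓝 X := inter_mem hs (Ioo_mem_nhds h.mem.1 h.mem.2)
  obtain ⟨ε, hε, hball⟩ := Metric.mem_nhds_iff.1 hs'
  have hsub : ∀ z, |z - X| ≤ ε / 2 → z ∈ s ∩ Ioo (1 / 2) 1 := fun z hz =>
    hball (by rw [Metric.mem_ball, Real.dist_eq]; linarith)
  have hlo := hsub (X - ε / 2) (by simp [abs_of_pos (half_pos hε)])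
  have hhi := hsub (X + ε / 2) (by simp [abs_of_pos (half_pos hε)])
  have hc : ∀ z : ℝ, Continuous fun q : ℝ × ℝ => (lineMap q.1 q.2)^[m] z - z - N := fun z => by
    have := (continuous_lineMap_iterate m).comp (Continuous.prodMk_left z)
    simp only [Function.comp_def] at this
    fun_prop
  have hlam := h.contracting
  have h₁ : 0 < (lineMap α b)^[m] (X - ε / 2) - (X - ε / 2) - N := by
    have := neg_le_of_abs_le (h.abs_sub_le ⟨hlo.2.1.le, hlo.2.2.le⟩)
    rw [show X - ε / 2 - X = -(ε / 2) by ring, abs_neg, abs_of_pos (by positivity)] at this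
    nlinarith
  have h₂ : (lineMap α b)^[m] (X + ε / 2) - (X + ε / 2) - N < 0 := by
    have := le_of_abs_le (h.abs_sub_le ⟨hhi.2.1.le, hhi.2.2.le⟩)
    rw [show X + ε / 2 - X = ε / 2 by ring, abs_of_pos (by positivity)] at this
    nlinarith
  filter_upwards [(hc (X - ε / 2)).continuousAt.eventually (lt_mem_nhds h₁),
    (hc (X + ε / 2)).continuousAt.eventually (gt_mem_nhds h₂)] with q hq₁ hq₂
  have hcont : ContinuousOn (fun z => (lineMap q.1 q.2)^[m] z - z - N)
      (Icc (X - ε / 2) (X + ε / 2)) := by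
    have := continuous_lineMap_iterate_right q.1 q.2 m
    fun_prop
  obtain ⟨z, hz, hz'⟩ := intermediate_value_Icc' (by linarith) hcont ⟨hq₂.le, hq₁.le⟩
  refine ⟨z, (hsub z (abs_le.2 ⟨by linarith [hz.1], by linarith [hz.2]⟩)).1, ?_⟩
  simp only at hz'
  linarith

end SingleMinusPt

lemma exists_mem_Ioo_of_mem_Iplus {w : ℝ} (h : (w : UnitAddCircle) ∈ Iplus)
    (h₀ : (w : UnitAddCircle) ≠ 0) (h₁ : (w : UnitAddCircle) ≠ ((1 / 2 : ℝ) : UnitAddCircle)) :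
    ∃ n : ℤ, w ∈ Ioo (n : ℝ) (n + 1 / 2) := by
  obtain ⟨t, ht, htw⟩ := h
  simp only at htw
  rw [← htw] at h₀ h₁
  have ht₀ : 0 < t := lt_of_le_of_ne ht.1 (by rintro rfl; simp at h₀)
  have ht₁ : t < 1 / 2 := lt_of_le_of_ne ht.2 (by rintro rfl; exact h₁ rfl)
  obtain ⟨n, rfl⟩ := coe_eq_coe_iff_int.1 htw.symm
  exact ⟨n, by linarith, by linarith⟩

lemma exists_mem_Ioo_of_mem_Iminus {w : ℝ} (h : (w : UnitAddCircle) ∈ Iminus)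
    (h₀ : (w : UnitAddCircle) ≠ 0) (h₁ : (w : UnitAddCircle) ≠ ((1 / 2 : ℝ) : UnitAddCircle)) :
    ∃ n : ℤ, w ∈ Ioo (n + 1 / 2 : ℝ) (n + 1) := by
  obtain ⟨t, ht, htw⟩ := h
  simp only at htw
  rw [← htw] at h₀ h₁
  have ht₀ : t < 1 := lt_of_le_of_ne ht.2 (by rintro rfl; simp at h₀)
  have ht₁ : 1 / 2 < t := lt_of_le_of_ne ht.1 (by rintro rfl; exact h₁ rfl)
  obtain ⟨n, rfl⟩ := coe_eq_coe_iff_int.1 htw.symm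
  exact ⟨n, by linarith, by linarith⟩

lemma coe_ne_of_mem_Ioo {w t : ℝ} {n : ℤ} (h₁ : t + n < w) (h₂ : w < t + n + 1) :
    (w : UnitAddCircle) ≠ (t : UnitAddCircle) := by
  intro h
  rw [← coe_add_int t n] at h
  have := eq_of_coe_eq h (by linarith) (by linarith)
  linarith

lemma coe_mem_Iplus {w : ℝ} {n : ℤ} (h : w ∈ Ioo (n : ℝ) (n + 1 / 2)) :
    (w : UnitAddCircle) ∈ Iplus ∧ (w : UnitAddCircle) ≠ 0 ∧
      (w : UnitAddCircle) ≠ ((1 / 2 : ℝ) : UnitAddCircle) := by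
  refine ⟨⟨w - n, ⟨by linarith [h.1], by linarith [h.2]⟩, ?_⟩, ?_, ?_⟩
  · exact coe_eq_coe_iff_int.2 ⟨-n, by push_cast; ring⟩
  · exact coe_ne_of_mem_Ioo (t := 0) (n := n) (by linarith [h.1]) (by linarith [h.2])
  · exact coe_ne_of_mem_Ioo (n := n - 1) (by push_cast; linarith [h.1])
      (by push_cast; linarith [h.2])

lemma coe_mem_Iminus {w : ℝ} {n : ℤ} (h : w ∈ Ioo (n + 1 / 2 : ℝ) (n + 1)) :
    (w : UnitAddCircle) ∈ Iminus ∧ (w : UnitAddCircle) ≠ 0 ∧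
      (w : UnitAddCircle) ≠ ((1 / 2 : ℝ) : UnitAddCircle) := by
  refine ⟨⟨w - n, ⟨by linarith [h.1], by linarith [h.2]⟩, ?_⟩, ?_, ?_⟩
  · exact coe_eq_coe_iff_int.2 ⟨-n, by push_cast; ring⟩
  · exact coe_ne_of_mem_Ioo (t := 0) (n := n) (by linarith [h.1]) (by linarith [h.2])
  · exact coe_ne_of_mem_Ioo (n := n) (by linarith [h.1]) (by linarith [h.2])

lemma countable_preorbit {α b : ℝ} (hb : 0 ≤ b) (hb' : b < 1) (X : ℝ) :
    {Y : ℝ | ∃ (K : ℕ) (n : ℤ), (lineMap α b)^[K] Y = X + n}.Countable := by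
  have : {Y : ℝ | ∃ (K : ℕ) (n : ℤ), (lineMap α b)^[K] Y = X + n} =
      ⋃ (K : ℕ) (n : ℤ), {Y | (lineMap α b)^[K] Y = X + n} := by
    ext; simp
  rw [this]
  refine countable_iUnion fun K => countable_iUnion fun n => Set.Subsingleton.countable ?_
  intro y hy z hz
  exact ((strictMono_lineMap hb hb').iterate K).injective (hy.trans hz.symm)

/-- An affine local expression of slope at least one is incompatible with attraction. -/
lemma slope_lt_one_of_attracting {α b X l : ℝ} {m : ℕ} (hb : 0 ≤ b) (hb' : b < 1)
    (h : IsAttractingPeriodicPt (plpdm α b) m (X : UnitAddCircle))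
    (hl : ∀ᶠ z in 𝓝 X, (lineMap α b)^[m] z - (lineMap α b)^[m] X = l * (z - X)) : l < 1 := by
  obtain ⟨-, hper, -, U, hU, -, hXU, -, hlim⟩ := h
  by_contra! hl1
  rw [plpdm_iterate_coe] at hper
  obtain ⟨N, hN⟩ := coe_eq_coe_iff_int.1 hper
  have hl0 : 0 < l := by linarith
  obtain ⟨δ, hδ, hball⟩ := Metric.eventually_nhds_iff.1 hl
  obtain ⟨Y, hYU, hY⟩ : ∃ Y : ℝ, (Y : UnitAddCircle) ∈ U ∧
      ∀ (K : ℕ) (n : ℤ), (lineMap α b)^[K] Y ≠ X + n := by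
    have hd := (countable_preorbit (α := α) hb hb' X).dense_compl ℝ
    obtain ⟨Y, hY, hYU⟩ := hd.exists_mem_open
      (hU.preimage (AddCircle.continuous_mk' (1 : ℝ))) ⟨X, hXU⟩
    refine ⟨Y, hYU, fun K n e => hY ⟨K, n, e⟩⟩
  set d : ℕ → ℝ := fun k => ‖(((lineMap α b)^[m * k] Y - X : ℝ) : UnitAddCircle)‖ with hd
  have hdlim : Tendsto d atTop (𝓝 0) := by
    have := (tendsto_iff_norm_sub_tendsto_zero.1 (hlim _ hYU))
    refine this.congr fun k => ?_
    rw [plpdm_iterate_coe, ← AddCircle.coe_sub]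
  have hdpos : ∀ k, 0 < d k := fun k => by
    refine norm_pos_iff.2 fun h0 => ?_
    rw [AddCircle.coe_sub, sub_eq_zero] at h0
    obtain ⟨n, hn⟩ := coe_eq_coe_iff_int.1 h0
    exact hY _ _ hn
  have hstep : ∀ k, d k < min δ (1 / 2 / l) → d k ≤ d (k + 1) := by
    intro k hk
    obtain ⟨n, t, ht, hdt⟩ : ∃ (n : ℤ) (t : ℝ),
        (lineMap α b)^[m * k] Y = X + t + n ∧ d k = |t| := by
      refine ⟨round ((lineMap α b)^[m * k] Y - X),
        (lineMap α b)^[m * k] Y - X - round ((lineMap α b)^[m * k] Y - X), by ring, ?_⟩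
      exact UnitAddCircle.norm_eq
    have ht₁ : |t| < δ := hdt ▸ hk.trans_le (min_le_left _ _)
    have ht₂ : l * |t| < 1 / 2 := by
      have := hdt ▸ hk.trans_le (min_le_right _ _)
      rw [lt_div_iff₀ hl0] at this
      linarith
    have e := hball (y := X + t) (by simpa [Real.dist_eq] using ht₁)
    have e' : (lineMap α b)^[m * (k + 1)] Y - X = l * t + ((N + 2 ^ m * n : ℤ) : ℝ) := by
      rw [show m * (k + 1) = m + m * k by ring, Function.iterate_add_apply, ht,
        lineMap_iterate_add_int]
      push_cast
      linarith
    have habs : |l * t| = l * |t| := by rw [abs_mul, abs_of_pos hl0]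
    have : d (k + 1) = |l * t| := by
      simp only [hd]
      rw [e', coe_add_int]
      refine (AddCircle.norm_coe_eq_abs_iff 1 one_ne_zero).2 ?_
      rw [habs]
      simpa using ht₂.le
    rw [this, hdt, habs]
    nlinarith [abs_nonneg t]
  obtain ⟨K, hK⟩ := eventually_atTop.1
    (hdlim.eventually (gt_mem_nhds (lt_min hδ (by positivity : 0 < 1 / 2 / l))))
  have hge : ∀ k, d K ≤ d (K + k) := fun k => by
    induction k with
    | zero => rfl
    | succ k ih => exact ih.trans (hstep _ (hK _ (Nat.le_add_right _ _)))
  have := ge_of_tendsto' ((tendsto_add_atTop_iff_nat K).2 hdlim)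
    (fun k => by rw [add_comm]; exact hge k)
  linarith [hdpos K]

lemma eventually_iterate_sub_eq {α b X : ℝ} {m : ℕ} {s : ℕ → ℝ}
    (hs : ∀ i < m, ∀ᶠ w in 𝓝 ((lineMap α b)^[i] X),
      lineMap α b w - lineMap α b ((lineMap α b)^[i] X) = s i * (w - (lineMap α b)^[i] X)) :
    ∀ᶠ z in 𝓝 X, (lineMap α b)^[m] z - (lineMap α b)^[m] X =
      (∏ i ∈ Finset.range m, s i) * (z - X) := by
  induction m with
  | zero => simp
  | succ m ih =>
    filter_upwards [ih fun i hi => hs i (by omega),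
      (continuous_lineMap_iterate_right α b m).continuousAt.eventually (hs m (by omega))]
      with z hz hz'
    rw [Function.iterate_succ_apply', Function.iterate_succ_apply', hz', hz,
      Finset.prod_range_succ]
    ring

/-- A parameter with a single minus attracting orbit has a single minus point. -/
lemma exists_singleMinusPt {α b : ℝ} (h : ((α : UnitAddCircle), b) ∈ singleMinusParams) :
    ∃ m N X, SingleMinusPt α b m N X := by
  obtain ⟨⟨hb, hb'⟩, m, x, σ, ⟨j₀, hj₀, huniq⟩, hatt, hne, hit⟩ := h
  simp only at hb hb' hatt hne hit huniq
  obtain ⟨X, rfl⟩ : ∃ X : ℝ, (X : UnitAddCircle) = x := QuotientAddGroup.mk_surjective x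
  have hne' := fun j : Fin m => plpdm_iterate_coe α b X j ▸ hne j
  have hit' := fun j : Fin m => plpdm_iterate_coe α b X j ▸ hit j
  have hm := hatt.1
  have hl := slope_lt_one_of_attracting hb hb' hatt
    (eventually_iterate_sub_eq (m := m)
      (s := fun i => if i = j₀ then 2 - 2 * b else 2 + 2 * b) fun i hi => by
        split_ifs with hij
        · obtain ⟨n, hn⟩ := exists_mem_Ioo_of_mem_Iminus ((hit' ⟨i, hi⟩).1 (by
            rwa [show (⟨i, hi⟩ : Fin m) = j₀ from Fin.ext hij])) (hne' ⟨i, hi⟩).1 (hne' ⟨i, hi⟩).2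
          filter_upwards [Ioo_mem_nhds hn.1 hn.2] with w hw
          exact lineMap_sub_of_minus n (Ioo_subset_Icc_self hw) (Ioo_subset_Icc_self hn)
        · obtain ⟨n, hn⟩ := exists_mem_Ioo_of_mem_Iplus ((hit' ⟨i, hi⟩).2 (by
            by_contra hσ
            exact hij (congrArg Fin.val (huniq ⟨i, hi⟩ (by simpa using hσ)))))
            (hne' ⟨i, hi⟩).1 (hne' ⟨i, hi⟩).2
          filter_upwards [Ioo_mem_nhds hn.1 hn.2] with w hw
          exact lineMap_sub_of_plus n (Ioo_subset_Icc_self hw) (Ioo_subset_Icc_self hn))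
  have hprod : ∏ i ∈ Finset.range m, (if i = j₀ then 2 - 2 * b else 2 + 2 * b) =
      (2 + 2 * b) ^ (m - 1) * (2 - 2 * b) := by
    rw [← Finset.mul_prod_erase _ _ (Finset.mem_range.2 j₀.2), if_pos rfl, mul_comm]
    congr 1
    rw [Finset.prod_congr rfl fun i hi => if_neg (Finset.ne_of_mem_erase hi),
      Finset.prod_const, Finset.card_erase_of_mem (Finset.mem_range.2 j₀.2), Finset.card_range]
  rw [hprod] at hl
  obtain ⟨n, hn⟩ := exists_mem_Ioo_of_mem_Iminus ((hit' j₀).1 hj₀) (hne' j₀).1 (hne' j₀).2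
  have hper : (plpdm α b)^[m] (((lineMap α b)^[j₀] X - n : ℝ) : UnitAddCircle) =
      (((lineMap α b)^[j₀] X - n : ℝ) : UnitAddCircle) := by
    have e : (((lineMap α b)^[j₀] X - n : ℝ) : UnitAddCircle) =
        (plpdm α b)^[j₀] (X : UnitAddCircle) := by
      rw [plpdm_iterate_coe]
      exact coe_eq_coe_iff_int.2 ⟨-n, by push_cast; ring⟩
    rw [e]
    exact Function.IsPeriodicPt.apply_iterate hatt.2.1 j₀
  rw [plpdm_iterate_coe] at hper
  obtain ⟨N, hN⟩ := coe_eq_coe_iff_int.1 hper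
  exact ⟨m, N, _, hb, hb'.le, hm, ⟨by linarith [hn.1], by linarith [hn.2]⟩, hN, hl⟩

/-- A single minus point whose later iterates lie in the plus arc gives a parameter with a
single minus attracting orbit. -/
lemma SingleMinusPt.mem_singleMinusParams {α b : ℝ} {m : ℕ} {N : ℤ} {X : ℝ}
    (h : SingleMinusPt α b m N X) (hb : b < 1)
    (hit : ∀ i, 0 < i → i < m → ∃ n : ℤ, (lineMap α b)^[i] X ∈ Ioo (n : ℝ) (n + 1 / 2)) :
    ((α : UnitAddCircle), b) ∈ singleMinusParams := by
  have hX := coe_mem_Iminus (w := X) (n := 0) (by simpa using h.mem)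
  refine ⟨⟨h.nonneg, hb⟩, m, X, fun j => decide (j = ⟨0, h.pos⟩), ⟨⟨0, h.pos⟩, by simp, by simp⟩,
    h.isAttractingPeriodicPt fun i hi him => ?_, fun j => ?_, fun j => ?_⟩
  · obtain ⟨n, hn⟩ := hit i hi him
    rw [plpdm_iterate_coe]
    exact coe_ne_of_mem_Ioo (n := n - 1) (by push_cast; linarith [hn.1, h.mem.2])
      (by push_cast; linarith [hn.2, h.mem.1])
  · rcases Nat.eq_zero_or_pos j with hj | hj
    · simpa [hj] using hX.2
    · obtain ⟨n, hn⟩ := hit j hj j.2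
      simp only [plpdm_iterate_coe]
      exact (coe_mem_Iplus hn).2
  · rcases Nat.eq_zero_or_pos j with hj | hj
    · have : j = ⟨0, h.pos⟩ := Fin.ext hj
      simpa [this] using hX.1
    · have : j ≠ ⟨0, h.pos⟩ := fun e => hj.ne' (congrArg Fin.val e)
      obtain ⟨n, hn⟩ := hit j hj j.2
      simpa [this, plpdm_iterate_coe] using (coe_mem_Iplus hn).1

/-- The map with parameter `q` has periodic points on the arc of minus slope, and the
semiconjugacy sends all of them to `c`. -/
def HasType (q : UnitAddCircle × ℝ) (c : UnitAddCircle) : Prop :=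
  (∃ n > 0, ∃ y ∈ Iminus, Function.IsPeriodicPt (plpdm q.1 q.2) n y) ∧
    ∀ n > 0, ∀ y ∈ Iminus, Function.IsPeriodicPt (plpdm q.1 q.2) n y → phiMap q.1 q.2 y = c

lemma HasType.unique {q : UnitAddCircle × ℝ} {c c' : UnitAddCircle} (h : HasType q c)
    (h' : HasType q c') : c = c' := by
  obtain ⟨⟨n, hn, y, hy, hp⟩, h⟩ := h
  exact (h n hn y hy hp).symm.trans (h'.2 n hn y hy hp)

lemma hasType_of_periodic {α b X : ℝ} {m : ℕ} {N : ℤ}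
    (hq : ((α : UnitAddCircle), b) ∈ singleMinusParams) (hm : 0 < m)
    (hX : X ∈ Ioo (1 / 2 : ℝ) 1) (h : (lineMap α b)^[m] X = X + N) :
    HasType ((α : UnitAddCircle), b) ((N / (2 ^ m - 1) : ℝ) : UnitAddCircle) := by
  have hp : Function.IsPeriodicPt (plpdm α b) m (X : UnitAddCircle) := by
    change (plpdm α b)^[m] (X : UnitAddCircle) = X
    rw [plpdm_iterate_coe, h, coe_add_int]
  refine ⟨⟨m, hm, X, ⟨X, ⟨hX.1.le, hX.2.le⟩, rfl⟩, hp⟩, ?_⟩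
  rintro n hn _ ⟨Y, hY, rfl⟩ hYp
  obtain ⟨m', N', X', h'⟩ := exists_singleMinusPt hq
  have e : Y = X := (h'.eq_of_periodic hY hn hYp).trans
    (h'.eq_of_periodic ⟨hX.1.le, hX.2.le⟩ hm hp).symm
  simp only [e]
  exact phiMap_of_periodic hm ⟨by linarith [hX.1], hX.2⟩ h

/-- The type is locally constant on the single minus parameters. -/
lemma eventually_hasType {q : UnitAddCircle × ℝ} (hq : q ∈ singleMinusParams) :
    ∃ c, HasType q c ∧ ∀ᶠ q' in 𝓝[singleMinusParams] q, HasType q' c := by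
  obtain ⟨a, b⟩ := q
  obtain ⟨α, rfl⟩ : ∃ α : ℝ, (α : UnitAddCircle) = a := QuotientAddGroup.mk_surjective a
  obtain ⟨m, N, X, h⟩ := exists_singleMinusPt hq
  refine ⟨_, hasType_of_periodic hq h.pos h.mem h.iterate_eq, ?_⟩
  have hopen : IsOpenMap (Prod.map (fun t : ℝ => (t : UnitAddCircle)) (id : ℝ → ℝ)) :=
    IsOpenMap.prodMap QuotientAddGroup.isOpenMap_coe IsOpenMap.id
  have hV := hopen.image_mem_nhds (h.persists (Ioo_mem_nhds h.mem.1 h.mem.2))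
  filter_upwards [mem_nhdsWithin_of_mem_nhds hV, self_mem_nhdsWithin] with q' hq' hq's
  obtain ⟨⟨α', b'⟩, ⟨X', hX', hX'p⟩, rfl⟩ := hq'
  exact hasType_of_periodic hq's h.pos hX' hX'p

lemma hasType_of_mem_connectedComponentIn {q₀ q : UnitAddCircle × ℝ} {c : UnitAddCircle}
    (h₀ : HasType q₀ c) (hq : q ∈ connectedComponentIn singleMinusParams q₀) : HasType q c := by
  set S := connectedComponentIn singleMinusParams q₀
  have hS : S ⊆ singleMinusParams := connectedComponentIn_subset _ _
  have hq₀ : q₀ ∈ singleMinusParams := connectedComponentIn_nonempty_iff.1 ⟨q, hq⟩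
  refine (isPreconnected_connectedComponentIn.induction₂
    (fun q q' => ∀ c, HasType q c ↔ HasType q' c) (s := S) ?_
    (fun _ _ _ _ _ _ h₁ h₂ c => (h₁ c).trans (h₂ c)) (fun _ _ _ _ h c => (h c).symm)
    (mem_connectedComponentIn hq₀) hq c).1 h₀
  intro q₁ hq₁
  obtain ⟨c₁, hc₁, hev⟩ := eventually_hasType (hS hq₁)
  filter_upwards [nhdsWithin_mono _ hS hev] with q₂ hc₂ c
  exact ⟨fun h => h.unique hc₁ ▸ hc₂, fun h => h.unique hc₂ ▸ hc₁⟩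

/-- At `b = 1` some translation makes the midpoint of the collapsed arc periodic with prescribed
displacement. -/
lemma exists_superattracting_param {p : ℕ} (hp : 1 ≤ p) (k : ℕ) :
    ∃ α : ℝ, (lineMap α 1)^[p] (3 / 4) = 3 / 4 + k := by
  have hc : Continuous fun α : ℝ => (lineMap α 1)^[p] (3 / 4) := by
    have := (continuous_lineMap_iterate p).comp
      ((Continuous.prodMk_left (1 : ℝ)).prodMk (continuous_const (y := (3 / 4 : ℝ))))
    simpa only [Function.comp_def] using this
  have h2 : (1 : ℝ) ≤ 2 ^ p - 1 := by
    have : (2 : ℝ) ^ 1 ≤ 2 ^ p := pow_le_pow_right₀ (by norm_num) hp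
    linarith
  set v := (lineMap 0 1)^[p] (3 / 4) with hv
  have hshift : ∀ l : ℤ, (lineMap l 1)^[p] (3 / 4) = v + (2 ^ p - 1) * l := fun l => by
    have := lineMap_param_add_int_iterate 0 1 (3 / 4) l p
    rwa [zero_add] at this
  set L : ℤ := ⌈|3 / 4 + k - v|⌉ with hL
  have hL₁ : |3 / 4 + (k : ℝ) - v| ≤ L := Int.le_ceil _
  have hL₂ := abs_le.1 hL₁
  have hL₀ : (0 : ℝ) ≤ L := (abs_nonneg _).trans hL₁
  refine mem_range_of_exists_le_of_exists_ge hc ⟨((-L : ℤ) : ℝ), ?_⟩ ⟨(L : ℝ), ?_⟩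
  · rw [hshift]
    push_cast
    nlinarith
  · rw [hshift]
    nlinarith

lemma iterate_mem_Ioo_of_lt_minimalPeriod {α X : ℝ} (hX : X ∈ Icc (1 / 2 : ℝ) 1)
    (hpos : 0 < Function.minimalPeriod (plpdm α 1) (X : UnitAddCircle)) {j : ℕ} (hj : 0 < j)
    (hjd : j < Function.minimalPeriod (plpdm α 1) (X : UnitAddCircle)) :
    ∃ n : ℤ, (lineMap α 1)^[j] X ∈ Ioo (n : ℝ) (n + 1 / 2) := by
  set f := plpdm α 1
  set x : UnitAddCircle := (X : UnitAddCircle) with hx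
  set d := Function.minimalPeriod f x
  have hd : f^[d] x = x := Function.iterate_minimalPeriod
  by_contra! hcon
  obtain ⟨n, hn⟩ : ∃ n : ℤ, (lineMap α 1)^[j] X ∈ Icc (n + 1 / 2 : ℝ) (n + 1) := by
    set w := (lineMap α 1)^[j] X
    have h₁ := Int.floor_le w
    have h₂ := Int.lt_floor_add_one w
    rcases h₁.eq_or_lt with h | h
    · exact ⟨⌊w⌋ - 1, by push_cast; linarith, by push_cast; linarith⟩
    · exact ⟨⌊w⌋, by by_contra! hlt; exact hcon _ ⟨h, hlt⟩, h₂.le⟩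
  have e := lineMap_sub_of_minus (α := α) (b := 1) (y := X + n) n hn
    ⟨by linarith [hX.1], by linarith [hX.2]⟩
  rw [lineMap_add_int] at e
  have hcol : f^[j + 1] x = f x := by
    rw [hx, plpdm_iterate_coe, show f X = _ from plpdm_coe α 1 X, Function.iterate_succ_apply',
      coe_eq_coe_iff_int]
    refine ⟨2 * n, ?_⟩
    push_cast
    linarith
  have hfix : f^[j] x = x := by
    have h₁ := congrArg f^[d - 1] hcol
    rw [← Function.iterate_add_apply, ← Function.iterate_succ_apply, Nat.succ_eq_add_one,
      Nat.sub_add_cancel hpos, hd, show d - 1 + (j + 1) = j + d by omega,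
      Function.iterate_add_apply, hd] at h₁
    exact h₁
  exact Function.not_isPeriodicPt_of_pos_of_lt_minimalPeriod hj.ne' hjd hfix

/-- Near a superattracting parameter at `b = 1`, all parameters with `b < 1` have a single minus
attracting orbit of the same displacement. -/
lemma SingleMinusPt.eventually_mem_singleMinusParams {α X : ℝ} {m : ℕ} {N : ℤ}
    (h : SingleMinusPt α 1 m N X)
    (hit : ∀ i, 0 < i → i < m → ∃ n : ℤ, (lineMap α 1)^[i] X ∈ Ioo (n : ℝ) (n + 1 / 2)) :
    ∀ᶠ q : ℝ × ℝ in 𝓝 (α, 1), q.2 < 1 →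
      ((q.1 : UnitAddCircle), q.2) ∈ singleMinusParams ∧
      HasType ((q.1 : UnitAddCircle), q.2) ((N / (2 ^ m - 1) : ℝ) : UnitAddCircle) := by
  have hopen : ∀ᶠ r : (ℝ × ℝ) × ℝ in 𝓝 (α, 1) ×ˢ 𝓝 X, ∀ i ∈ Finset.range m, 0 < i →
      ∃ n : ℤ, (lineMap r.1.1 r.1.2)^[i] r.2 ∈ Ioo (n : ℝ) (n + 1 / 2) := by
    rw [← nhds_prod_eq, Finset.eventually_all]
    intro i him
    rcases Nat.eq_zero_or_pos i with hi | hi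
    · exact Eventually.of_forall fun _ h => absurd hi h.ne'
    obtain ⟨n, hn⟩ := hit i hi (Finset.mem_range.1 him)
    filter_upwards [(continuous_lineMap_iterate i).continuousAt.eventually
      (Ioo_mem_nhds hn.1 hn.2)] with r hr _
    exact ⟨n, hr⟩
  obtain ⟨P, hP, s, hs, hPs⟩ := eventually_prod_iff.1 hopen
  have hrate : ∀ᶠ q : ℝ × ℝ in 𝓝 (α, 1), (2 + 2 * q.2) ^ (m - 1) * (2 - 2 * q.2) < 1 := by
    have : Continuous fun q : ℝ × ℝ => (2 + 2 * q.2) ^ (m - 1) * (2 - 2 * q.2) := by fun_prop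
    exact this.continuousAt.eventually (gt_mem_nhds h.contracting)
  have hpos : ∀ᶠ q : ℝ × ℝ in 𝓝 (α, 1), 0 < q.2 :=
    continuous_snd.continuousAt.eventually (lt_mem_nhds one_pos)
  filter_upwards [hP, hrate, hpos, h.persists (inter_mem hs (Ioo_mem_nhds h.mem.1 h.mem.2))]
    with q hqP hqr hq0 ⟨X', ⟨hX's, hX'⟩, hX'p⟩ hq1
  have hq : ((q.1 : UnitAddCircle), q.2) ∈ singleMinusParams :=
    SingleMinusPt.mem_singleMinusParams ⟨hq0.le, hq1.le, h.pos, hX', hX'p, hqr⟩ hq1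
      fun i hi him => hPs hqP hX's i (Finset.mem_range.2 him) hi
  exact ⟨hq, hasType_of_periodic hq h.pos hX' hX'p⟩

theorem stmt17 (p : ℕ) (hp : 1 ≤ p) (k : ℕ) (hk : k ≤ 2^p - 2) :
    ∃ S : Set (UnitAddCircle × ℝ),
      (∃ q₀ ∈ singleMinusParams, S = connectedComponentIn singleMinusParams q₀) ∧
      IsTongue S ∧
      ∀ q ∈ S, ∀ (m : ℕ) (x : UnitAddCircle),
        IsAttractingPeriodicPt (plpdm q.1 q.2) m x → x ∈ Iminus →
        phiMap q.1 q.2 x = (((k : ℝ) / (2^p - 1) : ℝ) : UnitAddCircle) := by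
  obtain ⟨α, hα⟩ := exists_superattracting_param hp k
  set x : UnitAddCircle := ((3 / 4 : ℝ) : UnitAddCircle) with hx
  have hxp : Function.IsPeriodicPt (plpdm α 1) p x := by
    change (plpdm α 1)^[p] x = x
    rw [plpdm_iterate_coe, hα]
    exact coe_add_int _ k
  set d := Function.minimalPeriod (plpdm α 1) x with hd
  have hdpos : 0 < d := hxp.minimalPeriod_pos hp
  have hdx : (plpdm α 1)^[d] x = x := Function.iterate_minimalPeriod
  rw [plpdm_iterate_coe] at hdx
  obtain ⟨N, hN⟩ := coe_eq_coe_iff_int.1 hdx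
  have hτ : (N / (2 ^ d - 1) : ℝ) = k / (2 ^ p - 1) := by
    have := tendsto_nhds_unique (tendsto_lineMap_iterate_div hdpos hN)
      (tendsto_lineMap_iterate_div (N := k) hp (by simpa using hα))
    simpa using this
  have hpt : SingleMinusPt α 1 d N (3 / 4) :=
    ⟨zero_le_one, le_rfl, hdpos, by norm_num, hN, by norm_num⟩
  have hev := hpt.eventually_mem_singleMinusParams fun i hi hid =>
    iterate_mem_Ioo_of_lt_minimalPeriod (by norm_num) hdpos hi hid
  rw [hτ] at hev
  obtain ⟨ε, hε, hball⟩ := Metric.eventually_nhds_iff.1 hev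
  have hbox : ∀ t ∈ Ioo (α - ε) (α + ε), ∀ b ∈ Ioo (1 - ε) 1,
      ((t : UnitAddCircle), b) ∈ singleMinusParams ∧
      HasType ((t : UnitAddCircle), b) ((k / (2 ^ p - 1) : ℝ) : UnitAddCircle) := by
    intro t ht b hb
    refine hball (y := (t, b)) ?_ hb.2
    rw [Prod.dist_eq, max_lt_iff, Real.dist_eq, Real.dist_eq, abs_lt, abs_lt]
    exact ⟨⟨by linarith [ht.1], by linarith [ht.2]⟩, by linarith [hb.1], by linarith [hb.2]⟩
  have hα_mem : α ∈ Ioo (α - ε) (α + ε) := ⟨by linarith, by linarith⟩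
  have hb_mem : 1 - ε / 2 ∈ Ioo (1 - ε) 1 := ⟨by linarith, by linarith⟩
  obtain ⟨hq₀, hq₀τ⟩ := hbox α hα_mem _ hb_mem
  have hsub : Prod.map (fun t : ℝ => (t : UnitAddCircle)) (id : ℝ → ℝ) ''
      (Ioo (α - ε) (α + ε) ×ˢ Ioo (1 - ε) 1) ⊆
      connectedComponentIn singleMinusParams ((α : UnitAddCircle), 1 - ε / 2) := by
    refine IsPreconnected.subset_connectedComponentIn ?_
      ⟨(α, 1 - ε / 2), ⟨hα_mem, hb_mem⟩, rfl⟩ ?_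
    · exact (isPreconnected_Ioo.prod isPreconnected_Ioo).image _
        ((AddCircle.continuous_mk' (1 : ℝ)).prodMap continuous_id).continuousOn
    · rintro _ ⟨⟨t, b⟩, ⟨ht, hb⟩, rfl⟩
      exact (hbox t ht b hb).1
  refine ⟨_, ⟨_, hq₀, rfl⟩, ⟨α - ε / 2, α + ε / 2, by linarith, fun t ht => ?_⟩, ?_⟩
  · have h1 : (1 : ℝ) ∈ closure (Ioo (1 - ε) 1) := by
      rw [closure_Ioo (by linarith)]
      exact ⟨by linarith, le_rfl⟩
    exact map_mem_closure (Continuous.prodMk_right (t : UnitAddCircle)) h1 fun b hb =>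
      hsub ⟨(t, b), ⟨⟨by linarith [ht.1], by linarith [ht.2]⟩, hb⟩, rfl⟩
  · intro q hq m y hy hyI
    exact (hasType_of_mem_connectedComponentIn hq₀τ hq).2 m hy.1 y hyI hy.2.1
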